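/- Let (a_i)_{i≥1} and (d_i)_{i≥1} be two infinite alternate Lyndon words over a finite alphabet A such that d_1d_2d_3⋯ ≺ a_1a_2a_3⋯ in the alternate order, and let log β > 0 be the topological entropy of the Lyndon system associated to (d_i)_{i≥1}. Then Σ_{n≥1} a_n/(−β)^n ≥ −β/(β+1). -/

import Mathlib

open Filter Topology

/-- Alternate (Ito–Sadahiro) strict order on infinite sequences (0-indexed: entry `i`
is the `(i+1)`-th letter `x_{i+1}` of the paper). `altLt x y` iff at the first index
where they differ the comparison alternates with the parity of the index:
`(-1)^k (x_k - y_k) < 0` in 1-based indexing. -/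
def altLt (x y : ℕ → ℕ) : Prop :=
  ∃ k : ℕ, (∀ i < k, x i = y i) ∧ (if Even k then y k < x k else x k < y k)

def altLe (x y : ℕ → ℕ) : Prop := x = y ∨ altLt x y

def shiftSeq (x : ℕ → ℕ) (k : ℕ) : ℕ → ℕ := fun i => x (k + i)

/-- An alternate Lyndon word: smaller (in the alternate order) than all of its shifts. -/
def IsAltLyndon (d : ℕ → ℕ) : Prop := ∀ k : ℕ, altLe d (shiftSeq d k)

/-- The Lyndon system associated to `d`: sequences over the alphabet `{0, …, d_1}`
all of whose shifts dominate `d` in the alternate order. -/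
def LyndonSystem (d : ℕ → ℕ) : Set (ℕ → ℕ) :=
  {x | (∀ i, x i ≤ d 0) ∧ ∀ k : ℕ, altLe d (shiftSeq x k)}

def IsFactorOf (w : List ℕ) (x : ℕ → ℕ) : Prop :=
  ∃ k : ℕ, w = (List.range w.length).map (fun i => x (k + i))

/-- The language of the Lyndon system: finite factors of its elements. -/
def LyndonLang (d : ℕ → ℕ) : Set (List ℕ) :=
  {w | ∃ x ∈ LyndonSystem d, IsFactorOf w x}

/-- `Hword d n` is the number of words of length `n` in the language `L_M`. -/
noncomputable def Hword (d : ℕ → ℕ) (n : ℕ) : ℕ :=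
  Set.ncard {w : List ℕ | w ∈ LyndonLang d ∧ w.length = n}

/-- The topological entropy of the Lyndon system of `d` equals `h`,
i.e. `lim_{n→∞} (log H_n)/n = h`. -/
def EntropyIs (d : ℕ → ℕ) (h : ℝ) : Prop :=
  Filter.Tendsto (fun n : ℕ => Real.log (Hword d n) / n) Filter.atTop (nhds h)

lemma altLe_iff (x y : ℕ → ℕ) :
    altLe x y ↔ y 0 < x 0 ∨ (x 0 = y 0 ∧ altLe (shiftSeq y 1) (shiftSeq x 1)) := by
  constructor
  · rintro (rfl | ⟨k, hk, h⟩)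
    · exact Or.inr ⟨rfl, Or.inl rfl⟩
    · rcases k with _ | k
      · left; simpa using h
      · right
        refine ⟨hk 0 (by omega), Or.inr ⟨k, fun i hi => ?_, ?_⟩⟩
        · simp only [shiftSeq]
          exact (hk (1 + i) (by omega)).symm
        · simp only [shiftSeq, Nat.even_add_one, Nat.add_comm 1 k] at h ⊢
          by_cases hE : Even k <;> simpa [hE] using h
  · rintro (h | ⟨h0, h | ⟨k, hk, h⟩⟩)
    · exact Or.inr ⟨0, by simp, by simpa using h⟩
    · left
      funext i
      rcases i with _ | i
      · exact h0
      · have := congrFun h i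
        simp only [shiftSeq, Nat.add_comm 1 i] at this
        exact this.symm
    · right
      refine ⟨k + 1, fun i hi => ?_, ?_⟩
      · rcases i with _ | i
        · exact h0
        · have := hk i (by omega)
          simp only [shiftSeq, Nat.add_comm 1 i] at this
          exact this.symm
      · simp only [shiftSeq, Nat.even_add_one, Nat.add_comm 1 k] at h ⊢
        by_cases hE : Even k <;> simpa [hE] using h

lemma altLe_refl (x : ℕ → ℕ) : altLe x x := Or.inl rfl

lemma altLe_total (x y : ℕ → ℕ) : altLe x y ∨ altLe y x := by
  by_cases hxy : x = y
  · exact Or.inl (Or.inl hxy)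
  · have hex : ∃ k, x k ≠ y k := Function.ne_iff.mp hxy
    classical
    have h1 := Nat.find_spec hex
    have h2 : ∀ i < Nat.find hex, x i = y i := fun i hi => by
      simpa using Nat.find_min hex hi
    by_cases hE : Even (Nat.find hex)
    · rcases lt_or_gt_of_ne h1 with h | h
      · exact Or.inr (Or.inr ⟨_, fun i hi => (h2 i hi).symm, by simpa [hE] using h⟩)
      · exact Or.inl (Or.inr ⟨_, h2, by simpa [hE] using h⟩)
    · rcases lt_or_gt_of_ne h1 with h | h
      · exact Or.inl (Or.inr ⟨_, h2, by rw [if_neg hE]; exact h⟩)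
      · exact Or.inr (Or.inr ⟨_, fun i hi => (h2 i hi).symm, by rw [if_neg hE]; exact h⟩)

lemma altLe_trans {x y z : ℕ → ℕ} (h1 : altLe x y) (h2 : altLe y z) : altLe x z := by
  rcases h1 with rfl | ⟨k, hk, h⟩
  · exact h2
  rcases h2 with rfl | ⟨l, hl, h'⟩
  · exact Or.inr ⟨k, hk, h⟩
  right
  rcases lt_trichotomy k l with hkl | rfl | hkl
  · refine ⟨k, fun i hi => (hk i hi).trans (hl i (hi.trans hkl)), ?_⟩
    rw [← hl k hkl]; exact h
  · refine ⟨k, fun i hi => (hk i hi).trans (hl i hi), ?_⟩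
    split_ifs at h h' ⊢
    · exact h'.trans h
    · exact h.trans h'
  · refine ⟨l, fun i hi => (hk i (hi.trans hkl)).trans (hl i hi), ?_⟩
    rw [hk l hkl]; exact h'

/-- prefix of length n -/
def pre : ℕ → (ℕ → ℕ) → List ℕ
  | 0, _ => []
  | n + 1, x => x 0 :: pre n (shiftSeq x 1)

lemma pre_eq (n : ℕ) (x : ℕ → ℕ) : pre n x = (List.range n).map x := by
  induction n generalizing x with
  | zero => rfl
  | succ n ih =>
    rw [pre, ih, List.range_succ_eq_map, List.map_cons, List.map_map]
    congr 1
    apply List.map_congr_left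
    intro i _
    simp [shiftSeq, Nat.add_comm]

lemma pre_convex (n : ℕ) : ∀ x y z : ℕ → ℕ, altLe x y → altLe y z → pre n x = pre n z →
    pre n y = pre n x := by
  induction n with
  | zero => intros; rfl
  | succ n ih =>
    intro x y z h1 h2 h
    simp only [pre, List.cons.injEq] at h ⊢
    rw [altLe_iff] at h1 h2
    have hy : x 0 = y 0 := by omega
    have h1' := (h1.resolve_left (by omega)).2
    have h2' := (h2.resolve_left (by omega)).2
    exact ⟨hy.symm, (ih _ _ _ h2' h1' h.2.symm).trans h.2.symm⟩

lemma shift_shift (x : ℕ → ℕ) (j k : ℕ) : shiftSeq (shiftSeq x j) k = shiftSeq x (j + k) := by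
  funext i; simp [shiftSeq, Nat.add_assoc]

lemma shift_mem {d x : ℕ → ℕ} (hx : x ∈ LyndonSystem d) (j : ℕ) :
    shiftSeq x j ∈ LyndonSystem d :=
  ⟨fun i => hx.1 _, fun k => by rw [shift_shift]; exact hx.2 _⟩

lemma lyndon_le {a : ℕ → ℕ} (ha : IsAltLyndon a) (k : ℕ) : a k ≤ a 0 := by
  have := (altLe_iff _ _).1 (ha k)
  simp only [shiftSeq, Nat.add_zero] at this
  omega

lemma self_mem {a : ℕ → ℕ} (ha : IsAltLyndon a) : a ∈ LyndonSystem a := ⟨lyndon_le ha, ha⟩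

def consSeq (c : ℕ) (y : ℕ → ℕ) : ℕ → ℕ
  | 0 => c
  | n + 1 => y n

lemma shift_cons (c : ℕ) (y : ℕ → ℕ) (k : ℕ) : shiftSeq (consSeq c y) (k + 1) = shiftSeq y k := by
  funext i; simp only [shiftSeq]; rw [show k + 1 + i = (k + i) + 1 by omega]; rfl

lemma shift_zero (y : ℕ → ℕ) : shiftSeq y 0 = y := by funext i; simp [shiftSeq]

lemma shift_cons_one (c : ℕ) (y : ℕ → ℕ) : shiftSeq (consSeq c y) 1 = y := by
  rw [shift_cons c y 0, shift_zero]

lemma cons_mem {a y : ℕ → ℕ} {c : ℕ} (hy : y ∈ LyndonSystem a) (hc : c ≤ a 0)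
    (h : altLe a (consSeq c y)) : consSeq c y ∈ LyndonSystem a := by
  refine ⟨fun i => ?_, fun k => ?_⟩
  · rcases i with _ | i
    · exact hc
    · exact hy.1 i
  · rcases k with _ | k
    · rw [shift_zero]; exact h
    · rw [shift_cons]; exact hy.2 k

/-- upper words and lower words -/
def upW (a y : ℕ → ℕ) (n : ℕ) : Set (List ℕ) := pre n '' {x | x ∈ LyndonSystem a ∧ altLe y x}
def loW (a y : ℕ → ℕ) (n : ℕ) : Set (List ℕ) := pre n '' {x | x ∈ LyndonSystem a ∧ altLe x y}
def allW (a : ℕ → ℕ) (n : ℕ) : Set (List ℕ) := pre n '' LyndonSystem a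

lemma allW_finite (a : ℕ → ℕ) (n : ℕ) : (allW a n).Finite := by
  induction n with
  | zero =>
    apply (Set.finite_singleton ([] : List ℕ)).subset
    rintro _ ⟨x, _, rfl⟩
    rfl
  | succ n ih =>
    apply (((Set.finite_Iic (a 0)).prod ih).image (fun p => p.1 :: p.2)).subset
    rintro _ ⟨x, hx, rfl⟩
    exact ⟨(x 0, pre n (shiftSeq x 1)), ⟨hx.1 0, ⟨_, shift_mem hx 1, rfl⟩⟩, rfl⟩

lemma upW_sub (a y : ℕ → ℕ) (n : ℕ) : upW a y n ⊆ allW a n := Set.image_mono fun _ h => h.1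
lemma loW_sub (a y : ℕ → ℕ) (n : ℕ) : loW a y n ⊆ allW a n := Set.image_mono fun _ h => h.1

lemma up_add_lo {a y : ℕ → ℕ} (hy : y ∈ LyndonSystem a) (n : ℕ) :
    (upW a y n).ncard + (loW a y n).ncard = (allW a n).ncard + 1 := by
  have hU : upW a y n ∪ loW a y n = allW a n := by
    apply Set.Subset.antisymm (Set.union_subset (upW_sub _ _ _) (loW_sub _ _ _))
    rintro _ ⟨x, hx, rfl⟩
    rcases altLe_total y x with h | h
    · exact Or.inl ⟨x, ⟨hx, h⟩, rfl⟩
    · exact Or.inr ⟨x, ⟨hx, h⟩, rfl⟩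
  have hI : upW a y n ∩ loW a y n = {pre n y} := by
    apply Set.Subset.antisymm
    · rintro _ ⟨⟨x, hx, rfl⟩, ⟨x', hx', h⟩⟩
      have := pre_convex n x' y x hx'.2 hx.2 h
      rw [Set.mem_singleton_iff, this, h]
    · rintro _ rfl
      exact ⟨⟨y, ⟨hy, altLe_refl y⟩, rfl⟩, ⟨y, ⟨hy, altLe_refl y⟩, rfl⟩⟩
  rw [← Set.ncard_union_add_ncard_inter _ _ ((allW_finite a n).subset (upW_sub _ _ _))
    ((allW_finite a n).subset (loW_sub _ _ _)), hU, hI, Set.ncard_singleton]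

lemma up_succ {a : ℕ → ℕ} (ha : IsAltLyndon a) (k n : ℕ) :
    (upW a (shiftSeq a k) (n + 1)).ncard =
      a k * (allW a n).ncard + (loW a (shiftSeq a (k + 1)) n).ncard := by
  have hS : upW a (shiftSeq a k) (n + 1) = (fun p : ℕ × List ℕ => p.1 :: p.2) ''
      ((Set.Iio (a k) ×ˢ allW a n) ∪ ({a k} ×ˢ loW a (shiftSeq a (k + 1)) n)) := by
    apply Set.Subset.antisymm
    · rintro _ ⟨x, ⟨hx, h⟩, rfl⟩
      refine ⟨(x 0, pre n (shiftSeq x 1)), ?_, rfl⟩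
      rcases (altLe_iff _ _).1 h with h | ⟨h0, h⟩
      · left
        exact ⟨h, ⟨_, shift_mem hx 1, rfl⟩⟩
      · right
        rw [shift_shift] at h
        exact ⟨h0.symm, ⟨_, ⟨shift_mem hx 1, h⟩, rfl⟩⟩
    · rintro _ ⟨⟨c, w⟩, h | h, rfl⟩
      · obtain ⟨hc, y, hy, hw⟩ := h
        simp only at hw
        subst hw
        have hc : c < a k := hc
        have hk := lyndon_le ha k
        refine ⟨consSeq c y, ⟨cons_mem hy (by omega) ?_, ?_⟩, ?_⟩
        · rw [altLe_iff]; left; show c < a 0; omega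
        · rw [altLe_iff]; left; exact hc
        · simp only [pre, shift_cons_one]; rfl
      · obtain ⟨hc, y, ⟨hy, hle⟩, hw⟩ := h
        simp only at hw
        subst hw
        have hc : c = a k := hc
        subst hc
        have h1 : altLe (shiftSeq a k) (consSeq (a k) y) := by
          rw [altLe_iff]; right
          refine ⟨rfl, ?_⟩
          rw [shift_shift, shift_cons_one]; exact hle
        refine ⟨consSeq (a k) y, ⟨cons_mem hy (lyndon_le ha k) (altLe_trans (ha k) h1), h1⟩, ?_⟩
        simp only [pre, shift_cons_one]; rfl
  rw [hS, Set.ncard_image_of_injective]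
  · have f1 : (Set.Iio (a k) ×ˢ allW a n).Finite := (Set.finite_Iio _).prod (allW_finite a n)
    have f2 : (({a k} : Set ℕ) ×ˢ loW a (shiftSeq a (k + 1)) n).Finite :=
      (Set.finite_singleton _).prod ((allW_finite a n).subset (loW_sub _ _ _))
    rw [Set.ncard_union_eq (hs := f1) (ht := f2), Set.ncard_prod, Set.ncard_prod, Set.ncard_singleton, one_mul]
    · simp [Set.ncard_eq_toFinset_card']
    · rw [Set.disjoint_left]
      rintro ⟨c, w⟩ ⟨h, _⟩ ⟨h', _⟩
      have h : c < a k := h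
      have h' : c = a k := h'
      omega
  · rintro ⟨c, w⟩ ⟨c', w'⟩ h
    simpa using h

lemma up_rec {a : ℕ → ℕ} (ha : IsAltLyndon a) (k n : ℕ) :
    (upW a (shiftSeq a k) (n + 1)).ncard + (upW a (shiftSeq a (k + 1)) n).ncard =
      (a k + 1) * (allW a n).ncard + 1 := by
  have h1 := up_succ ha k n
  have h2 := up_add_lo (shift_mem (self_mem ha) (k + 1)) n
  rw [h1]; linarith

lemma up_zero {a : ℕ → ℕ} (ha : IsAltLyndon a) (k : ℕ) :
    (upW a (shiftSeq a k) 0).ncard = 1 := by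
  have : upW a (shiftSeq a k) 0 = {[]} := by
    apply Set.Subset.antisymm
    · rintro _ ⟨x, _, rfl⟩; rfl
    · rintro _ rfl
      exact ⟨_, ⟨shift_mem (self_mem ha) k, altLe_refl _⟩, rfl⟩
  rw [this, Set.ncard_singleton]

lemma up_self {a : ℕ → ℕ} (n : ℕ) : upW a (shiftSeq a 0) n = allW a n := by
  apply Set.Subset.antisymm (upW_sub _ _ _)
  rintro _ ⟨x, hx, rfl⟩
  refine ⟨x, ⟨hx, ?_⟩, rfl⟩
  have := hx.2 0
  rwa [shift_zero] at this ⊢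

lemma Hword_eq (d : ℕ → ℕ) (n : ℕ) : Hword d n = (allW d n).ncard := by
  unfold Hword
  congr 1
  apply Set.Subset.antisymm
  · rintro w ⟨⟨x, hx, k, hk⟩, rfl⟩
    refine ⟨_, shift_mem hx k, ?_⟩
    rw [pre_eq]; exact hk.symm
  · rintro _ ⟨x, hx, rfl⟩
    refine ⟨⟨x, hx, 0, ?_⟩, ?_⟩
    · simp [pre_eq]
    · simp [pre_eq]

lemma system_sub {a d : ℕ → ℕ} (hlt : altLe d a) : LyndonSystem a ⊆ LyndonSystem d := by
  intro x hx
  have h0 := (altLe_iff _ _).1 hlt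
  exact ⟨fun i => (hx.1 i).trans (by omega), fun k => altLe_trans hlt (hx.2 k)⟩

lemma key {a : ℕ → ℕ} (ha : IsAltLyndon a) {z : ℝ} (hz0 : 0 < z) (hz1 : z < 1)
    (hs : Summable fun n => ((allW a n).ncard : ℝ) * z ^ n) :
    0 ≤ 1 / (1 + z) + ∑' n : ℕ, (a n : ℝ) * (-z) ^ (n + 1) := by
  set M : ℕ → ℕ → ℝ := fun k n => ((upW a (shiftSeq a k) n).ncard : ℝ) with hM
  set h : ℕ → ℝ := fun n => ((allW a n).ncard : ℝ) with hh
  have hMle : ∀ k n, M k n ≤ h n := fun k n => by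
    simp only [hM, hh]
    exact_mod_cast Set.ncard_le_ncard (upW_sub _ _ _) (allW_finite a n)
  have hM0 : ∀ k n, 0 ≤ M k n := fun k n => Nat.cast_nonneg _
  have hMs : ∀ k, Summable fun n => M k n * z ^ n := fun k =>
    Summable.of_nonneg_of_le (fun n => mul_nonneg (hM0 k n) (by positivity))
      (fun n => mul_le_mul_of_nonneg_right (hMle k n) (by positivity)) hs
  set G : ℕ → ℝ := fun k => ∑' n, M k n * z ^ n with hG
  set H : ℝ := ∑' n, h n * z ^ n with hH
  have hG0 : G 0 = H := by
    simp only [hG, hH, hM, hh, up_self]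
  have hGnn : ∀ k, 0 ≤ G k := fun k => tsum_nonneg fun n => mul_nonneg (hM0 k n) (by positivity)
  have hGle : ∀ k, G k ≤ H := fun k => Summable.tsum_le_tsum
    (fun n => mul_le_mul_of_nonneg_right (hMle k n) (by positivity)) (hMs k) hs
  have hgeo : Summable fun n : ℕ => z ^ n := summable_geometric_of_lt_one hz0.le hz1
  have hrec : ∀ k, G k + z * G (k + 1) = 1 / (1 - z) + z * (a k + 1) * H := by
    intro k
    have e1 : G k = 1 + ∑' n, M k (n + 1) * z ^ (n + 1) := by
      simp only [hG]
      rw [(hMs k).tsum_eq_zero_add]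
      simp [hM, up_zero ha]
    have e2 : ∀ n, M k (n + 1) * z ^ (n + 1) =
        z * (a k + 1) * (h n * z ^ n) + z * z ^ n - z * (M (k + 1) n * z ^ n) := by
      intro n
      have : M k (n + 1) + M (k + 1) n = (a k + 1) * h n + 1 := by
        simp only [hM, hh]; exact_mod_cast up_rec ha k n
      rw [pow_succ]
      linear_combination (z ^ n * z) * this
    rw [e1, tsum_congr e2, Summable.tsum_sub, Summable.tsum_add, tsum_mul_left, tsum_mul_left,
      tsum_mul_left, tsum_geometric_of_lt_one hz0.le hz1]
    · have : 1 - z ≠ 0 := by linarith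
      simp only [hG, hH]
      field_simp
      ring
    · exact hs.mul_left _
    · exact hgeo.mul_left _
    · exact (hs.mul_left _).add (hgeo.mul_left _)
    · exact (hMs _).mul_left _
  have habs : |(-z)| < 1 := by rw [abs_neg, abs_of_pos hz0]; exact hz1
  have hgs : Summable fun k : ℕ => (-z) ^ k := summable_geometric_of_abs_lt_one habs
  have hGs : Summable fun k => (-z) ^ k * G k := by
    apply Summable.of_norm_bounded (g := fun k => z ^ k * H) (hgeo.mul_right _)
    intro k
    rw [norm_mul, norm_pow, norm_neg, Real.norm_of_nonneg hz0.le, Real.norm_of_nonneg (hGnn k)]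
    exact mul_le_mul_of_nonneg_left (hGle k) (by positivity)
  have has : Summable fun k => (a k : ℝ) * (-z) ^ (k + 1) := by
    apply Summable.of_norm_bounded (g := fun k => (a 0 : ℝ) * (z ^ k * z))
      ((hgeo.mul_right _).mul_left _)
    intro k
    rw [norm_mul, norm_pow, norm_neg, Real.norm_of_nonneg hz0.le,
      Real.norm_of_nonneg (Nat.cast_nonneg _), pow_succ]
    exact mul_le_mul_of_nonneg_right (by exact_mod_cast lyndon_le ha k) (by positivity)
  have htel : ∑' k, (-z) ^ k * G k = H + ∑' k, (-z) ^ (k + 1) * G (k + 1) := by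
    rw [hGs.tsum_eq_zero_add, pow_zero, one_mul, hG0]
  have e3 : ∀ k, (-z) ^ k * G k = (1 / (1 - z) + z * H) * (-z) ^ k
      - H * ((a k : ℝ) * (-z) ^ (k + 1)) + (-z) ^ (k + 1) * G (k + 1) := by
    intro k
    have := hrec k
    rw [pow_succ]
    linear_combination (-z) ^ k * this
  rw [tsum_congr e3, Summable.tsum_add ((hgs.mul_left _).sub (has.mul_left _))
    ((summable_nat_add_iff 1).2 hGs), Summable.tsum_sub (hgs.mul_left _) (has.mul_left _),
    tsum_mul_left, tsum_mul_left, tsum_geometric_of_abs_lt_one habs] at htel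
  have hf : H * (1 / (1 + z) + ∑' n : ℕ, (a n : ℝ) * (-z) ^ (n + 1)) = 1 / ((1 - z) * (1 + z)) := by
    have h1 : 1 - z ≠ 0 := by linarith
    have h2 : 1 + z ≠ 0 := by linarith
    have h3 : (1 / (1 - z) + z * H) * (1 - -z)⁻¹ - H * ∑' n : ℕ, (a n : ℝ) * (-z) ^ (n + 1) = H := by
      linarith
    rw [sub_neg_eq_add] at h3
    have h4 : H * ∑' n : ℕ, (a n : ℝ) * (-z) ^ (n + 1)
      = (1 / (1 - z) + z * H) * (1 + z)⁻¹ - H := by linarith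
    rw [mul_add, h4]
    field_simp
    ring
  have hHnn : 0 ≤ H := hG0 ▸ hGnn 0
  have hpos : 0 < 1 / ((1 - z) * (1 + z)) := by
    have : 0 < 1 - z := by linarith
    positivity
  rw [← hf] at hpos
  exact (pos_of_mul_pos_right hpos hHnn).le

lemma summable_of_entropy {d : ℕ → ℕ} {β z : ℝ} (hβ : 1 < β) (hE : EntropyIs d (Real.log β))
    (hz0 : 0 < z) (hz : z < 1 / β) : Summable fun n => (Hword d n : ℝ) * z ^ n := by
  have hβ0 : 0 < β := by linarith
  have hβz : β < 1 / z := by rwa [lt_one_div hβ0 hz0]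
  obtain ⟨g, hg1, hg2⟩ := exists_between hβz
  have hg0 : 0 < g := by linarith
  have hgz : g * z < 1 := by rwa [lt_div_iff₀ hz0] at hg2
  have hev := hE.eventually (gt_mem_nhds (Real.log_lt_log hβ0 hg1))
  apply Summable.of_norm_bounded_eventually_nat (g := fun n => (g * z) ^ n)
    (summable_geometric_of_lt_one (by positivity) hgz)
  filter_upwards [hev, eventually_gt_atTop 0] with n hn hn0
  rw [Real.norm_of_nonneg (by positivity), mul_pow]
  apply mul_le_mul_of_nonneg_right _ (by positivity)
  rcases (Nat.cast_nonneg (Hword d n) : (0 : ℝ) ≤ _).eq_or_lt with h | h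
  · rw [← h]; positivity
  · rw [← Real.log_le_log_iff h (by positivity), Real.log_pow]
    have : (0 : ℝ) < n := by exact_mod_cast hn0
    rw [div_lt_iff₀ this] at hn
    linarith

theorem stmt13 (a d : ℕ → ℕ) (ha : IsAltLyndon a) (hd : IsAltLyndon d)
    (hlt : altLt d a) (β : ℝ)
    (hE : EntropyIs d (Real.log β)) (hpos : 0 < Real.log β) :
    -β / (β + 1) ≤ ∑' n : ℕ, (a n : ℝ) / (-β) ^ (n + 1) := by
  have habs : 1 < |β| := by
    rw [← Real.log_abs] at hpos
    by_contra hcon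
    exact absurd (Real.log_nonpos (abs_nonneg β) (not_lt.1 hcon)) (not_le.2 hpos)
  rcases lt_abs.1 habs with hβ | hβ
  swap
  · have h1 : -β / (β + 1) ≤ 0 := div_nonpos_of_nonneg_of_nonpos (by linarith) (by linarith)
    refine h1.trans (tsum_nonneg fun n => ?_)
    have : 0 < -β := by linarith
    positivity
  have hβ0 : 0 < β := by linarith
  have hb1 : 1 / β < 1 := by rw [div_lt_one hβ0]; exact hβ
  have hb0 : 0 < 1 / β := by positivity
  set D : ℝ → ℝ := fun z => 1 / (1 + z) + ∑' n : ℕ, (a n : ℝ) * (-z) ^ (n + 1) with hD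
  have hcont : ContinuousOn D (Set.Icc 0 (1 / β)) := by
    apply ContinuousOn.add
    · apply ContinuousOn.div continuousOn_const (by fun_prop)
      intro z hz
      have := hz.1
      positivity
    · apply continuousOn_tsum (u := fun n => (a 0 : ℝ) * ((1 / β) ^ n * (1 / β)))
      · intro n; fun_prop
      · exact ((summable_geometric_of_lt_one hb0.le hb1).mul_right _).mul_left _
      · intro n z hz
        rw [norm_mul, norm_pow, norm_neg, Real.norm_of_nonneg hz.1,
          Real.norm_of_nonneg (Nat.cast_nonneg _), ← pow_succ]
        have hz1 := hz.1
        have hz2 := hz.2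
        have := lyndon_le ha n
        gcongr
  have hDnn : ∀ z ∈ Set.Ioo 0 (1 / β), 0 ≤ D z := by
    intro z hz
    apply key ha hz.1 (hz.2.trans hb1)
    apply Summable.of_nonneg_of_le _ _ (summable_of_entropy hβ hE hz.1 hz.2)
    · intro n; have := hz.1; positivity
    · intro n
      rw [Hword_eq]
      have := hz.1
      apply mul_le_mul_of_nonneg_right _ (by positivity)
      exact_mod_cast Set.ncard_le_ncard (Set.image_mono (system_sub (Or.inr hlt)))
        (allW_finite d n)
  have hfin : 0 ≤ D (1 / β) := by
    have hc : ContinuousWithinAt D (Set.Ioo 0 (1 / β)) (1 / β) :=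
      (hcont (1 / β) ⟨hb0.le, le_rfl⟩).mono Set.Ioo_subset_Icc_self
    haveI : (𝓝[Set.Ioo 0 (1 / β)] (1 / β)).NeBot := by
      rw [nhdsWithin_Ioo_eq_nhdsLT hb0]; infer_instance
    exact ge_of_tendsto hc (by filter_upwards [self_mem_nhdsWithin] with z hz using hDnn z hz)
  have e : ∑' n : ℕ, (a n : ℝ) / (-β) ^ (n + 1) = ∑' n : ℕ, (a n : ℝ) * (-(1 / β)) ^ (n + 1) := by
    apply tsum_congr
    intro n
    rw [div_eq_mul_inv, ← inv_pow, inv_neg, one_div]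
  rw [e]
  have e2 : -β / (β + 1) = -(1 / (1 + 1 / β)) := by
    field_simp
  rw [e2]
  simp only [hD] at hfin
  linarith
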